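/- Let A be a symmetric s×s integer matrix with det A = ±1, and let σ(A) denote the signature of A, i.e. the number of positive eigenvalues minus the number of negative eigenvalues of A regarded as a real symmetric matrix. If w ∈ ℤ^s is characteristic for A, then wᵗAw ≡ σ(A) (mod 8). (Van der Blij's lemma, used to show that sign P(Γ) − w·w is divisible by 8, so that μ̄ is an integer.) -/

import Mathlib

open Matrix

/-- A vector `w ∈ ℤ^s` is *characteristic* for a symmetric `s × s` integer matrix `A`
if `wᵗAx ≡ xᵗAx (mod 2)` for every `x ∈ ℤ^s`. -/
def IsCharacteristic {s : ℕ} (A : Matrix (Fin s) (Fin s) ℤ) (w : Fin s → ℤ) : Prop :=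
  ∀ x : Fin s → ℤ, w ⬝ᵥ A.mulVec x ≡ x ⬝ᵥ A.mulVec x [ZMOD 2]

/-- The signature of a symmetric integer matrix `A`: the number of positive real
eigenvalues minus the number of negative real eigenvalues of `A` regarded as a real
symmetric matrix. (If the real matrix is not Hermitian, i.e. `A` is not symmetric,
we return the junk value `0`.) -/
noncomputable def intSignature {s : ℕ} (A : Matrix (Fin s) (Fin s) ℤ) : ℤ :=
  if h : (A.map ((↑) : ℤ → ℝ)).IsHermitian then
    ((Finset.univ.filter fun i => 0 < h.eigenvalues i).card : ℤ) -
    ((Finset.univ.filter fun i => h.eigenvalues i < 0).card : ℤ)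
  else 0


open Complex Filter Topology in
lemma theta_split (a : ℕ) (ha : 0 < a) (hev : Even a) (t : ℝ) (ht : 0 < t) :
    jacobiTheta (1 / a + I / (a ^ 2 * t)) =
      ∑ r : Fin a, cexp (Real.pi * I * (r : ℕ) ^ 2 / a) *
        (HurwitzZeta.evenKernel (((r : ℕ) / a : ℝ) : UnitAddCircle) (1 / t) : ℂ) := by
  have : NeZero a := ⟨ha.ne'⟩
  have ha' : (a : ℂ) ≠ 0 := by exact_mod_cast ha.ne'
  have ht' : (t : ℂ) ≠ 0 := by exact_mod_cast ht.ne'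
  set τ : ℂ := 1 / a + I / (a ^ 2 * t) with hτ
  have hτe : τ = ((1 / a : ℝ) : ℂ) + ((1 / (a ^ 2 * t) : ℝ) : ℂ) * I := by
    rw [hτ]; push_cast; ring
  have him : 0 < τ.im := by
    rw [hτe, add_im, ofReal_im, im_ofReal_mul, I_im]
    positivity
  have h0 := hasSum_jacobiTheta₂_term 0 him
  rw [← jacobiTheta_eq_jacobiTheta₂] at h0
  have h1 : HasSum (fun p : Fin a × ℤ => jacobiTheta₂_term (p.1 + p.2 * a) 0 τ) (jacobiTheta τ) := by
    have := ((Equiv.prodComm _ _).trans (Int.divModEquiv a).symm).hasSum_iff.mpr h0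
    convert this using 2 with p
    simp [Int.divModEquiv, add_comm]
  have h2 : ∀ r : Fin a, HasSum (fun j : ℤ => jacobiTheta₂_term (r + j * a) 0 τ)
      (cexp (Real.pi * I * (r : ℕ) ^ 2 / a) *
        (HurwitzZeta.evenKernel (((r : ℕ) / a : ℝ) : UnitAddCircle) (1 / t) : ℂ)) := by
    intro r
    have := HurwitzZeta.hasSum_int_evenKernel ((r : ℕ) / a : ℝ) (t := 1 / t) (by positivity)
    have := (hasSum_ofReal.mpr this).mul_left (cexp (Real.pi * I * (r : ℕ) ^ 2 / a))
    suffices hfe : ∀ j : ℤ, jacobiTheta₂_term (r + j * a) 0 τ = cexp (Real.pi * I * (r : ℕ) ^ 2 / a) * ((Real.exp (-Real.pi * (j + (r : ℕ) / a) ^ 2 * (1 / t)) : ℝ) : ℂ) by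
      simp only [hfe]
      exact this
    intro j
    obtain ⟨b, hb⟩ := hev
    simp only [jacobiTheta₂_term]
    push_cast
    rw [← Complex.exp_add, Complex.exp_eq_exp_iff_exists_int]
    refine ⟨r * j + j ^ 2 * b, ?_⟩
    have hb' : (a : ℂ) = 2 * b := by rw [hb]; push_cast; ring
    have hb0 : (b : ℂ) ≠ 0 := by rintro h; apply ha'; rw [hb', h]; ring
    rw [hτ]; push_cast
    simp only [hb']
    field_simp
    ring_nf
    simp [I_sq]
    ring
  have h3 := h1.prod_fiberwise h2
  exact h3.unique (hasSum_fintype _)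

open Complex Filter Topology in
lemma gauss_sum_eval (a : ℕ) (ha : 0 < a) (hev : Even a) :
    ∑ r : Fin a, cexp (Real.pi * I * (r : ℕ) ^ 2 / a) =
      (Real.sqrt a : ℂ) * cexp (Real.pi * I / 4) := by
  have ha' : (a : ℂ) ≠ 0 := by exact_mod_cast ha.ne'
  -- first limit
  have hcos : ∀ x : UnitAddCircle, Tendsto (fun t : ℝ => HurwitzZeta.cosKernel x t) atTop (𝓝 1) := by
    intro x
    obtain ⟨p, hp, h⟩ := HurwitzZeta.isBigO_atTop_cosKernel_sub x
    have h2 : Tendsto (fun x : ℝ => Real.exp (-p * x)) atTop (𝓝 0) := by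
      apply Real.tendsto_exp_atBot.comp
      exact (tendsto_id.const_mul_atTop_of_neg (by linarith))
    have := (h.trans_tendsto h2).add_const 1
    simpa using this
  have hL1 : Tendsto (fun t : ℝ => ∑ r : Fin a, cexp (Real.pi * I * (r : ℕ) ^ 2 / a) *
      (HurwitzZeta.cosKernel (((r : ℕ) / a : ℝ) : UnitAddCircle) t : ℂ)) atTop
      (𝓝 (∑ r : Fin a, cexp (Real.pi * I * (r : ℕ) ^ 2 / a))) := by
    apply tendsto_finsetSum
    intro r _
    have := (continuous_ofReal.tendsto 1).comp (hcos (((r : ℕ) / a : ℝ) : UnitAddCircle))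
    have := this.const_mul (cexp (Real.pi * I * (r : ℕ) ^ 2 / a))
    simpa using this
  have hper : ∀ (n : ℕ) (z : ℂ), jacobiTheta (2 * n + z) = jacobiTheta z := by
    intro n z
    induction n with
    | zero => simp
    | succ k ih => rw [← ih, ← jacobiTheta_two_add (2 * k + z)]; congr 1; push_cast; ring
  have hS : ∀ z : ℂ, 0 < z.im → jacobiTheta (-1 / z) = (-I * z) ^ (1 / 2 : ℂ) * jacobiTheta z := by
    intro z hz
    have := jacobiTheta_S_smul ⟨z, hz⟩
    rw [UpperHalfPlane.modular_S_smul] at this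
    dsimp only at this
    rw [← this]; congr 1
    simp [neg_div, inv_neg]
  have hth : Tendsto (fun t : ℝ => jacobiTheta (-1 / a + I * t)) atTop (𝓝 1) := by
    have h := isBigO_at_im_infty_jacobiTheta_sub_one
    have hk : Tendsto (fun t : ℝ => (-1 / a + I * t : ℂ)) atTop (comap im atTop) := by
      rw [tendsto_comap_iff]
      convert tendsto_id using 1
      ext t
      have : (-1 / a : ℂ) = ((-1 / a : ℝ) : ℂ) := by push_cast; ring
      simp [this, -ofReal_div]
    have h2 : Tendsto (fun τ : ℂ => Real.exp (-Real.pi * τ.im)) (comap im atTop) (𝓝 0) := by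
      apply Real.tendsto_exp_atBot.comp
      exact (tendsto_comap.const_mul_atTop_of_neg (by linarith [Real.pi_pos]))
    have := ((h.trans_tendsto h2).comp hk).add_const 1
    simpa [Function.comp_def] using this
  -- key identity
  have key : ∀ t : ℝ, 0 < t → ∑ r : Fin a, cexp (Real.pi * I * (r : ℕ) ^ 2 / a) *
      (HurwitzZeta.cosKernel (((r : ℕ) / a : ℝ) : UnitAddCircle) t : ℂ) =
      (-I * (-1 / (-1 / a + I * t) - a)) ^ (1 / 2 : ℂ) * (1 + I / (a * t)) ^ (1 / 2 : ℂ) *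
        jacobiTheta (-1 / a + I * t) := by
    intro t ht
    have ht' : (t : ℂ) ≠ 0 := by exact_mod_cast ht.ne'
    have h1 := theta_split a ha hev t ht
    simp only [HurwitzZeta.evenKernel_functional_equation, one_div_one_div] at h1
    have hsq : ((1 / (1 / t) ^ (1 / 2 : ℝ) : ℝ)) = t ^ (1 / 2 : ℝ) := by
      rw [one_div t, Real.inv_rpow ht.le]; simp
    simp only [hsq] at h1
    set u : ℂ := -1 / a + I * t with hu
    have hue : u = ((-1 / a : ℝ) : ℂ) + (t : ℂ) * I := by rw [hu]; push_cast; ring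
    have huim : 0 < u.im := by
      rw [hue, add_im, ofReal_im, im_ofReal_mul, I_im]; simpa using ht
    have hu0 : u ≠ 0 := by intro h; rw [h] at huim; simp at huim
    set v : ℂ := -1 / u - a with hv
    have hvim : 0 < v.im := by
      rw [hv, sub_im, natCast_im, sub_zero, neg_div, neg_im, one_div, inv_im, neg_div, neg_neg]
      exact div_pos huim (normSq_pos.mpr hu0)
    have hv0 : v ≠ 0 := by intro h; rw [h] at hvim; simp at hvim
    have hvτ : -1 / v = 1 / a + I / (a ^ 2 * t) := by
      rw [div_eq_iff hv0, hv]
      have : a * u = -1 + a * I * t := by rw [hu]; field_simp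
      have h2 : (1 / a + I / (a ^ 2 * t) : ℂ) = (a * t + I) / (a ^ 2 * t) := by field_simp
      rw [h2]
      field_simp
      linear_combination I * this + a * t * I_sq
    have hv2 := hS v hvim
    rw [hvτ, h1] at hv2
    obtain ⟨b, hb⟩ := hev
    have hv3 : jacobiTheta v = (-I * u) ^ (1 / 2 : ℂ) * jacobiTheta u := by
      rw [← hS u huim, ← hper b v]
      congr 1
      rw [hv, hb]; push_cast; ring
    have hsp : (-I * u) ^ (1 / 2 : ℂ) = (t ^ (1 / 2 : ℝ) : ℝ) * (1 + I / (a * t)) ^ (1 / 2 : ℂ) := by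
      have : -I * u = (t : ℂ) * (1 + I / (a * t)) := by
        rw [hu]; field_simp; linear_combination (-(t * a) : ℂ) * I_sq
      rw [this, Complex.ofReal_cpow ht.le]
      have hne : (1 + I / (a * t) : ℂ) ≠ 0 := by
        intro h; rw [h] at this; simp [hu0] at this
      rw [cpow_def_of_ne_zero (mul_ne_zero ht' hne), cpow_def_of_ne_zero ht',
        cpow_def_of_ne_zero hne, ← Complex.exp_add, Complex.log_ofReal_mul ht hne,
        ofReal_log ht.le]
      push_cast
      ring_nf
    rw [hv3, hsp] at hv2
    have htp : ((t ^ (1 / 2 : ℝ) : ℝ) : ℂ) ≠ 0 := by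
      exact_mod_cast (Real.rpow_pos_of_pos ht _).ne'
    apply mul_left_cancel₀ htp
    calc _ = _ := ?_
      _ = _ := hv2
      _ = _ := by ring
    rw [Finset.mul_sum]
    apply Finset.sum_congr rfl
    intro r _
    push_cast
    ring
  have hinv : Tendsto (fun t : ℝ => ((t : ℂ))⁻¹) atTop (𝓝 0) := by
    have := (continuous_ofReal.tendsto 0).comp tendsto_inv_atTop_zero
    simpa [Function.comp_def] using this
  have hL2 : Tendsto (fun t : ℝ => (-I * (-1 / (-1 / a + I * t) - a)) ^ (1 / 2 : ℂ) *
      (1 + I / (a * t)) ^ (1 / 2 : ℂ) * jacobiTheta (-1 / a + I * t)) atTop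
      (𝓝 ((I * a) ^ (1 / 2 : ℂ) * 1 * 1)) := by
    refine (Tendsto.mul ?_ ?_).mul hth
    · have hA : Tendsto (fun t : ℝ => (-I * (-1 / (-1 / a + I * t) - a) : ℂ)) atTop (𝓝 (I * a)) := by
        have hB : Tendsto (fun t : ℝ => (-I * ((-(t : ℂ)⁻¹) / (-1 / a * (t : ℂ)⁻¹ + I) - a) : ℂ)) atTop
            (𝓝 (-I * ((-0) / (-1 / a * 0 + I) - a))) := by
          refine ((hinv.neg.div ((hinv.const_mul _).add_const _) ?_).sub_const _).const_mul _
          simp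
        have e : (-I * ((-0) / (-1 / a * 0 + I) - a) : ℂ) = I * a := by simp
        rw [e] at hB
        refine hB.congr' ?_
        filter_upwards [eventually_gt_atTop 0] with t ht
        have ht' : (t : ℂ) ≠ 0 := by exact_mod_cast ht.ne'
        have : (-1 / a * (t : ℂ)⁻¹ + I : ℂ) = (-1 / a + I * t) / t := by field_simp
        rw [this]
        congr 2
        rw [div_div_eq_mul_div]
        congr 1
        field_simp
      refine Filter.Tendsto.comp (g := fun z : ℂ => z ^ (1 / 2 : ℂ)) (ContinuousAt.tendsto ?_) hA
      apply continuousAt_cpow_const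
      right; simp [ha.ne']
    · have hA : Tendsto (fun t : ℝ => (1 + I / (a * t) : ℂ)) atTop (𝓝 1) := by
        have := (hinv.const_mul (I / a)).const_add 1
        simp only [mul_zero, add_zero] at this
        refine this.congr fun t => ?_
        rw [div_mul_eq_div_div, div_eq_mul_inv (I / a)]
      have := (continuousAt_cpow_const (b := (1 / 2 : ℂ)) (a := 1) (by simp)).tendsto.comp hA
      simpa [Function.comp_def] using this
  have := tendsto_nhds_unique (hL1.congr' (by
    filter_upwards [eventually_gt_atTop 0] with t ht using key t ht)) hL2
  rw [this, mul_one, mul_one]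
  have hI : (I * a : ℂ) ≠ 0 := by simp [ha.ne']
  have har : (0 : ℝ) < a := by exact_mod_cast ha
  rw [cpow_def_of_ne_zero hI]
  have : (I * a : ℂ) = ((a : ℝ) : ℂ) * I := by push_cast; ring
  rw [this, Complex.log_ofReal_mul har I_ne_zero, Complex.log_I, add_mul, Complex.exp_add]
  congr 1
  · rw [Real.sqrt_eq_rpow, Complex.ofReal_cpow har.le, cpow_def_of_ne_zero (by simpa using ha')]
    rw [ofReal_log har.le]; push_cast; ring_nf
  · congr 1; ring

lemma inertia_le {n : ℕ} (S : Matrix (Fin n) (Fin n) ℝ) (a b : Fin n → ℝ)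
    (h : Sᵀ * diagonal a * S = diagonal b) :
    (Finset.univ.filter fun i => 0 < b i).card ≤ (Finset.univ.filter fun i => 0 < a i).card := by
  classical
  let E : ({i // 0 < b i} → ℝ) →ₗ[ℝ] (Fin n → ℝ) :=
    { toFun := fun x i => if hi : 0 < b i then x ⟨i, hi⟩ else 0
      map_add' := by intro x y; ext i; by_cases hi : 0 < b i <;> simp [hi]
      map_smul' := by intro x y; ext i; by_cases hi : 0 < b i <;> simp [hi] }
  let L : ({i // 0 < b i} → ℝ) →ₗ[ℝ] ({i // 0 < a i} → ℝ) :=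
    (LinearMap.funLeft ℝ ℝ (Subtype.val : {i // 0 < a i} → Fin n)) ∘ₗ (Matrix.toLin' S) ∘ₗ E
  have hL : Function.Injective L := by
    rw [← LinearMap.ker_eq_bot, LinearMap.ker_eq_bot']
    intro x hx
    have h1 : ∀ i, 0 < a i → (S *ᵥ E x) i = 0 := by
      intro i hi
      have := congrFun hx ⟨i, hi⟩
      simpa [L, LinearMap.funLeft] using this
    have h2 : E x ⬝ᵥ (diagonal b *ᵥ E x) = (S *ᵥ E x) ⬝ᵥ (diagonal a *ᵥ (S *ᵥ E x)) := by
      rw [← h, Matrix.mul_assoc, ← Matrix.mulVec_mulVec, ← Matrix.mulVec_mulVec,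
        Matrix.dotProduct_mulVec, Matrix.vecMul_transpose]
    have h3 : (S *ᵥ E x) ⬝ᵥ (diagonal a *ᵥ (S *ᵥ E x)) ≤ 0 := by
      simp only [dotProduct, mulVec_diagonal]
      apply Finset.sum_nonpos
      intro i _
      by_cases hi : 0 < a i
      · rw [h1 i hi]; simp
      · nlinarith [sq_nonneg ((S *ᵥ E x) i)]
    rw [← h2] at h3
    simp only [dotProduct, mulVec_diagonal] at h3
    have h4 : ∀ i ∈ Finset.univ, 0 ≤ E x i * (b i * E x i) := by
      intro i _
      by_cases hi : 0 < b i
      · nlinarith [mul_nonneg hi.le (sq_nonneg (E x i))]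
      · simp [E, hi]
    have h5 := (Finset.sum_eq_zero_iff_of_nonneg h4).mp (le_antisymm h3 (Finset.sum_nonneg h4))
    ext ⟨i, hi⟩
    have := h5 i (Finset.mem_univ _)
    simpa [E, hi, hi.ne'] using this
  have := LinearMap.finrank_le_finrank_of_injective hL
  simpa [Fintype.card_subtype] using this

lemma inertia_eq {n : ℕ} (A P : Matrix (Fin n) (Fin n) ℝ) (hA : A.IsHermitian) (d : Fin n → ℝ)
    (hP : P.det ≠ 0) (h : Pᵀ * A * P = diagonal d) :
    (Finset.univ.filter fun i => 0 < hA.eigenvalues i).card =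
      (Finset.univ.filter fun i => 0 < d i).card ∧
    (Finset.univ.filter fun i => hA.eigenvalues i < 0).card =
      (Finset.univ.filter fun i => d i < 0).card := by
  obtain ⟨U, hU1, hU2⟩ : ∃ U : Matrix (Fin n) (Fin n) ℝ, Uᵀ * U = 1 ∧
      A = U * diagonal hA.eigenvalues * Uᵀ := by
    refine ⟨hA.eigenvectorUnitary, ?_, ?_⟩
    · have := Matrix.mem_unitaryGroup_iff'.mp hA.eigenvectorUnitary.2
      simpa [star_eq_conjTranspose, conjTranspose_eq_transpose_of_trivial] using this
    · have := hA.spectral_theorem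
      rw [Unitary.conjStarAlgAut_apply] at this
      simpa [star_eq_conjTranspose, conjTranspose_eq_transpose_of_trivial, Function.comp_def] using this
  have hU3 : U * Uᵀ = 1 := mul_eq_one_comm.mp hU1
  have hPi : P * P⁻¹ = 1 := mul_nonsing_inv _ (by simpa using hP)
  have e1 : (Uᵀ * P)ᵀ * diagonal hA.eigenvalues * (Uᵀ * P) = diagonal d := by
    rw [← h]; conv_rhs => rw [hU2]
    simp only [transpose_mul, transpose_transpose, Matrix.mul_assoc]
  have e2 : (P⁻¹ * U)ᵀ * diagonal d * (P⁻¹ * U) = diagonal hA.eigenvalues := by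
    rw [← h]
    calc _ = Uᵀ * (P * P⁻¹)ᵀ * A * (P * P⁻¹) * U := by
          simp only [transpose_mul, Matrix.mul_assoc]
      _ = Uᵀ * A * U := by rw [hPi]; simp
      _ = (Uᵀ * U) * diagonal hA.eigenvalues * (Uᵀ * U) := by
          conv_lhs => rw [hU2]
          simp only [Matrix.mul_assoc]
      _ = _ := by rw [hU1]; simp
  have neg : ∀ (S : Matrix (Fin n) (Fin n) ℝ) (a b : Fin n → ℝ), Sᵀ * diagonal a * S = diagonal b →
      Sᵀ * diagonal (fun i => - a i) * S = diagonal (fun i => - b i) := by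
    intro S a b h
    have e : ∀ a : Fin n → ℝ, diagonal (fun i => - a i) = - diagonal a := fun a => by
      rw [Matrix.diagonal_neg]
    rw [e a, e b, ← h, Matrix.mul_neg, Matrix.neg_mul]
  refine ⟨le_antisymm (inertia_le _ _ _ e2) (inertia_le _ _ _ e1), ?_⟩
  have n1 := inertia_le _ _ _ (neg _ _ _ e1)
  have n2 := inertia_le _ _ _ (neg _ _ _ e2)
  simp only [Left.neg_pos_iff] at n1 n2
  exact le_antisymm n2 n1

lemma exists_diag {s : ℕ} (A : Matrix (Fin s) (Fin s) ℤ) (hsym : A.IsSymm) (hdet : A.det ≠ 0) :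
    ∃ (P : Matrix (Fin s) (Fin s) ℤ) (d : Fin s → ℤ), P.det ≠ 0 ∧ Pᵀ * A * P = diagonal d ∧
      ∀ i, d i ≠ 0 ∧ Even (d i) := by
  classical
  set AQ : Matrix (Fin s) (Fin s) ℚ := A.map (Int.castRingHom ℚ) with hAQ
  have hsQ : AQ.IsSymm := hsym.map _
  have hB : LinearMap.IsSymm (Matrix.toBilin' AQ) := by
    constructor
    intro x y
    simp only [Matrix.toBilin'_apply', RingHom.id_apply]
    rw [dotProduct_comm, ← Matrix.vecMul_transpose, hsQ.eq, Matrix.dotProduct_mulVec]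
  obtain ⟨v, hv⟩ := LinearMap.BilinForm.exists_orthogonal_basis hB
  have hf : Module.finrank ℚ (Fin s → ℚ) = s := by simp
  let v' := v.reindex (finCongr hf)
  have hv' : ∀ i j, i ≠ j → v' i ⬝ᵥ AQ *ᵥ v' j = 0 := by
    intro i j hij
    rw [← Matrix.toBilin'_apply']
    simp only [v', Module.Basis.reindex_apply]
    exact hv (by simpa using hij)
  -- matrix
  let PQ : Matrix (Fin s) (Fin s) ℚ := fun i j => v' j i
  have hPQ : PQ.det ≠ 0 := by
    have : LinearIndependent ℚ PQᵀ.row := v'.linearIndependent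
    rw [Matrix.linearIndependent_rows_iff_isUnit, Matrix.isUnit_iff_isUnit_det] at this
    simpa using this
  obtain ⟨N, hN⟩ := IsLocalization.exist_integer_multiples_of_finset (nonZeroDivisors ℤ)
    (S := ℚ) (Finset.univ.image fun p : Fin s × Fin s => PQ p.1 p.2)
  have hN' : ∀ i j, ∃ z : ℤ, (z : ℚ) = (N : ℤ) * PQ i j := by
    intro i j
    obtain ⟨z, hz⟩ := hN (PQ i j) (Finset.mem_image.mpr ⟨(i, j), Finset.mem_univ _, rfl⟩)
    exact ⟨z, by simpa using hz⟩
  choose Z hZ using hN'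
  have hN0 : ((N : ℤ) : ℚ) ≠ 0 := by
    exact_mod_cast nonZeroDivisors.ne_zero N.2
  let P : Matrix (Fin s) (Fin s) ℤ := Matrix.of fun i j => 2 * Z i j
  have hP : P.map (Int.castRingHom ℚ) = (2 * ((N : ℤ) : ℚ)) • PQ := by
    ext i j; simp [P, hZ, mul_assoc]
  have hPdet : P.det ≠ 0 := by
    have : (P.map (Int.castRingHom ℚ)).det ≠ 0 := by
      rw [hP, det_smul]
      exact mul_ne_zero (pow_ne_zero _ (mul_ne_zero two_ne_zero hN0)) hPQ
    intro h
    apply this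
    have := (RingHom.map_det (Int.castRingHom ℚ) P).symm
    rw [h] at this
    simpa using this
  have hoff : ∀ i j, i ≠ j → (Pᵀ * A * P) i j = 0 := by
    intro i j hij
    have e : ((Pᵀ * A * P).map (Int.castRingHom ℚ)) i j = 0 := by
      rw [Matrix.map_mul, Matrix.map_mul, transpose_map, hP, ← hAQ]
      simp only [transpose_smul, Matrix.smul_mul, Matrix.mul_smul, Matrix.smul_apply]
      have : (PQᵀ * AQ * PQ) i j = v' i ⬝ᵥ AQ *ᵥ v' j := by
        rw [Matrix.mul_assoc]
        rfl
      rw [this, hv' i j hij]; simp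
    simpa using e
  have hD : Pᵀ * A * P = diagonal (fun i => (Pᵀ * A * P) i i) := by
    ext i j
    by_cases hij : i = j
    · subst hij; simp
    · rw [hoff i j hij, diagonal_apply_ne _ hij]
  refine ⟨P, fun i => (Pᵀ * A * P) i i, hPdet, hD, fun i => ⟨?_, ?_⟩⟩
  · have : (Pᵀ * A * P).det ≠ 0 := by
      rw [det_mul, det_mul, det_transpose]
      exact mul_ne_zero (mul_ne_zero hPdet hdet) hPdet
    rw [hD, det_diagonal] at this
    exact Finset.prod_ne_zero_iff.mp this i (Finset.mem_univ _)
  · have : P = (2 : ℤ) • Matrix.of Z := by ext; simp [P]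
    change Even ((Pᵀ * A * P) i i)
    rw [this, transpose_smul, Matrix.smul_mul, Matrix.smul_mul, Matrix.smul_apply, smul_eq_mul]
    exact even_two_mul _

lemma zgauss_pos (a b : ℕ) (ha : 0 < a) (hb : 0 < b) (hev : Even a) (m : ℕ) [NeZero m] (hm : m = 2 * b * a) :
    ∃ r : ℝ, 0 < r ∧ ∑ k : ZMod m, ZMod.stdAddChar ((b : ZMod m) * k ^ 2) =
      r * Complex.exp (Real.pi * Complex.I / 4) := by
  refine ⟨2 * b * Real.sqrt a, by positivity, ?_⟩
  have h1 : ∑ k : ZMod m, ZMod.stdAddChar ((b : ZMod m) * k ^ 2) =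
      ∑ k : Fin m, (ZMod.stdAddChar ((b : ZMod m) * ((k : ℕ) : ZMod m) ^ 2) : ℂ) := by
    symm
    refine Fintype.sum_bijective (fun k : Fin m => ((k : ℕ) : ZMod m)) ?_ _ _ (fun _ => rfl)
    rw [Fintype.bijective_iff_injective_and_card]
    refine ⟨?_, by simp [ZMod.card]⟩
    intro x y hxy
    have := congrArg ZMod.val hxy
    simp only [ZMod.val_natCast, Nat.mod_eq_of_lt x.2, Nat.mod_eq_of_lt y.2] at this
    exact Fin.ext this
  have ha' : (a : ℂ) ≠ 0 := by exact_mod_cast ha.ne'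
  have hb' : (b : ℂ) ≠ 0 := by exact_mod_cast hb.ne'
  have h2 : ∀ k : ℕ, (ZMod.stdAddChar ((b : ZMod m) * ((k : ℕ) : ZMod m) ^ 2) : ℂ) =
      Complex.exp (Real.pi * Complex.I * k ^ 2 / a) := by
    intro k
    have : ((b : ZMod m) * ((k : ℕ) : ZMod m) ^ 2) = ((b * k ^ 2 : ℤ) : ZMod m) := by push_cast; rfl
    rw [this, ZMod.stdAddChar_coe, hm]
    push_cast
    congr 1
    field_simp
  rw [h1]
  simp only [h2]
  subst hm
  rw [← finProdFinEquiv.sum_comp, Fintype.sum_prod_type]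
  have h3 : ∀ (i : Fin (2 * b)) (j : Fin a),
      Complex.exp (Real.pi * Complex.I * ((finProdFinEquiv (i, j) : Fin (2 * b * a)) : ℕ) ^ 2 / a) =
      Complex.exp (Real.pi * Complex.I * (j : ℕ) ^ 2 / a) := by
    intro i j
    obtain ⟨c, hc⟩ := hev
    rw [finProdFinEquiv_apply_val, Complex.exp_eq_exp_iff_exists_int]
    refine ⟨j * i + c * i ^ 2, ?_⟩
    have : (a : ℂ) = 2 * c := by rw [hc]; push_cast; ring
    push_cast
    have hc0 : (c : ℂ) ≠ 0 := by rintro h; apply ha'; rw [this, h]; ring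
    rw [this]
    field_simp
    ring
  simp only [h3, gauss_sum_eval a ha hev]
  simp
  ring

/-- The orthogonality plus shift argument. -/
lemma main_sum {s : ℕ} (A P B : Matrix (Fin s) (Fin s) ℤ) (hsym : A.IsSymm)
    (hBA : B * A = 1) (c d w : Fin s → ℤ) (q : ℕ) (hq : 0 < q) (m : ℕ) [NeZero m] (hm : m = 8 * q)
    (hP : P.det ≠ 0)
    (hPAP : Pᵀ * A * P = diagonal d) (hcd : ∀ i, 2 * c i * d i = m)
    (hw : ∀ x : Fin s → ℤ, w ⬝ᵥ A.mulVec x ≡ x ⬝ᵥ A.mulVec x [ZMOD 2]) :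
    ∃ n : ℕ, ∑ k : Fin s → ZMod m, (ZMod.stdAddChar (∑ i, (c i : ZMod m) * k i ^ 2) : ℂ) =
      n * ZMod.stdAddChar ((q * (w ⬝ᵥ A *ᵥ w) : ℤ) : ZMod m) := by
  classical
  -- integer identities
  have tdot : ∀ (M : Matrix (Fin s) (Fin s) ℤ) (x y : Fin s → ℤ),
      x ⬝ᵥ M *ᵥ y = (Mᵀ *ᵥ x) ⬝ᵥ y := by
    intro M x y
    rw [Matrix.dotProduct_mulVec, Matrix.mulVec_transpose]
  have hT : (A * P)ᵀ = Pᵀ * A := by rw [transpose_mul, hsym.eq]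
  have hAdet : A.det ≠ 0 := by
    intro h
    have := congrArg det hBA
    rw [det_mul, h] at this
    simp at this
  have hX : (2 : ℤ) • (P * diagonal c * Pᵀ * A) = (m : ℤ) • 1 := by
    have h1 : Pᵀ * A * ((2 : ℤ) • (P * diagonal c * Pᵀ * A)) = Pᵀ * A * ((m : ℤ) • 1) := by
      have h2 : Pᵀ * A * ((2 : ℤ) • (P * diagonal c * Pᵀ * A)) =
          ((2 : ℤ) • ((Pᵀ * A * P) * diagonal c)) * (Pᵀ * A) := by
        simp only [Matrix.mul_smul, Matrix.smul_mul, Matrix.mul_assoc]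
      rw [h2, hPAP, diagonal_mul_diagonal]
      have h3 : (2 : ℤ) • (diagonal fun i => d i * c i) = (m : ℤ) • (1 : Matrix (Fin s) (Fin s) ℤ) := by
        rw [← diagonal_one, ← diagonal_smul, ← diagonal_smul]
        congr 1
        ext i
        simp only [Pi.smul_apply, smul_eq_mul]
        linarith [hcd i]
      rw [h3, Matrix.smul_mul, Matrix.mul_smul, Matrix.one_mul, Matrix.mul_one]
    have h4 : (Pᵀ * A).det ≠ 0 := by
      rw [det_mul, det_transpose]; exact mul_ne_zero hP hAdet
    have h5 : (Pᵀ * A).adjugate * (Pᵀ * A * ((2 : ℤ) • (P * diagonal c * Pᵀ * A))) =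
        (Pᵀ * A).adjugate * (Pᵀ * A * ((m : ℤ) • 1)) := by rw [h1]
    rw [← Matrix.mul_assoc _ (Pᵀ * A), ← Matrix.mul_assoc _ (Pᵀ * A), adjugate_mul,
      Matrix.smul_mul, Matrix.smul_mul, Matrix.one_mul, Matrix.one_mul] at h5
    exact smul_right_injective _ h4 h5
  -- Q as dot product
  have hQd : ∀ k : Fin s → ℤ, ∑ i, c i * k i ^ 2 = k ⬝ᵥ (diagonal c *ᵥ k) := by
    intro k
    simp only [dotProduct, mulVec_diagonal]
    exact Finset.sum_congr rfl fun i _ => by ring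
  have hQ : ∀ y : Fin s → ℤ, ∑ i, c i * ((Pᵀ * A) *ᵥ y) i ^ 2 = 4 * q * (y ⬝ᵥ A *ᵥ y) := by
    intro y
    have h2 : (2 : ℤ) * (∑ i, c i * ((Pᵀ * A) *ᵥ y) i ^ 2) = m * (y ⬝ᵥ A *ᵥ y) := by
      rw [hQd]
      have e : (Pᵀ * A) *ᵥ y ⬝ᵥ diagonal c *ᵥ (Pᵀ * A) *ᵥ y =
          y ⬝ᵥ (A * (P * diagonal c * Pᵀ * A)) *ᵥ y := by
        rw [← hT, ← tdot, hT]
        simp only [Matrix.mulVec_mulVec, Matrix.mul_assoc]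
      rw [e, ← smul_eq_mul, ← dotProduct_smul, ← Matrix.smul_mulVec, ← Matrix.mul_smul, hX,
        Matrix.mul_smul, Matrix.mul_one, Matrix.smul_mulVec, dotProduct_smul, smul_eq_mul]
    rw [hm] at h2; push_cast at h2; linarith
  have hpar : ∀ x : Fin s → ℤ, ∃ z : ℤ, x ⬝ᵥ A *ᵥ x + w ⬝ᵥ A *ᵥ x = 2 * z := by
    intro x
    have := (hw x).dvd
    obtain ⟨z, hz⟩ := this
    exact ⟨z + w ⬝ᵥ A *ᵥ x, by linarith⟩
  have hlift : ∀ k : Fin s → ZMod m, ∃ k' : Fin s → ℤ, ∀ i, (k' i : ZMod m) = k i := fun k =>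
    ⟨fun i => (ZMod.intCast_surjective (k i)).choose, fun i => (ZMod.intCast_surjective (k i)).choose_spec⟩
  choose lift hl using hlift
  have hmz : ((m : ℤ) : ZMod m) = 0 := by simp
  let φ := Int.castRingHom (ZMod m)
  let Q : (Fin s → ZMod m) → ZMod m := fun k => ∑ i, (c i : ZMod m) * k i ^ 2
  let M : Matrix (Fin s) (Fin s) (ZMod m) := (Pᵀ * A).map φ
  let v : (Fin s → ZMod m) → (Fin s → ZMod m) := fun k => fun j =>
    (((A * P * ((2 : ℤ) • diagonal c)) *ᵥ (lift k) - (4 * q : ℤ) • (A *ᵥ w)) j : ℤ)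
  have hMl : ∀ x i, (M *ᵥ x) i = ((((Pᵀ * A) *ᵥ lift x) i : ℤ) : ZMod m) := by
    intro x i
    simp only [M, mulVec, dotProduct, Matrix.map_apply]
    push_cast
    exact Finset.sum_congr rfl fun j _ => by rw [hl]; rfl
  have hshift : ∀ k x, Q (k + M *ᵥ x) = Q k + x ⬝ᵥ v k := by
    intro k x
    obtain ⟨z, hz⟩ := hpar (lift x)
    have e1 : Q (k + M *ᵥ x) = ((∑ i, c i * (lift k i + ((Pᵀ * A) *ᵥ lift x) i) ^ 2 : ℤ) : ZMod m) := by
      simp only [Q, Pi.add_apply, hMl]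
      push_cast
      simp only [hl]
    have e2 : Q k = ((∑ i, c i * (lift k i) ^ 2 : ℤ) : ZMod m) := by
      simp only [Q]
      push_cast
      simp only [hl]
    have e3 : x ⬝ᵥ v k = ((lift x ⬝ᵥ ((A * P * ((2 : ℤ) • diagonal c)) *ᵥ (lift k) - (4 * q : ℤ) • (A *ᵥ w)) : ℤ) : ZMod m) := by
      simp only [dotProduct, v]
      rw [Int.cast_sum]
      exact Finset.sum_congr rfl fun j _ => by rw [Int.cast_mul, hl]
    rw [e1, e2, e3]
    have e4 : (∑ i, c i * (lift k i + ((Pᵀ * A) *ᵥ lift x) i) ^ 2 : ℤ) =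
        (∑ i, c i * (lift k i) ^ 2) + lift x ⬝ᵥ (A * P * ((2 : ℤ) • diagonal c)) *ᵥ (lift k)
        + 4 * q * (lift x ⬝ᵥ A *ᵥ lift x) := by
      rw [← hQ]
      have : lift x ⬝ᵥ (A * P * ((2 : ℤ) • diagonal c)) *ᵥ (lift k) =
          ((Pᵀ * A) *ᵥ lift x) ⬝ᵥ (((2 : ℤ) • diagonal c) *ᵥ lift k) := by
        rw [← hT, ← tdot, Matrix.mulVec_mulVec]
      rw [this, Matrix.smul_mulVec]
      simp only [dotProduct, Pi.smul_apply, mulVec_diagonal, smul_eq_mul]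
      rw [← Finset.sum_add_distrib, ← Finset.sum_add_distrib]
      exact Finset.sum_congr rfl fun j _ => by ring
    have e5 : lift x ⬝ᵥ A *ᵥ w = w ⬝ᵥ A *ᵥ lift x := by
      rw [Matrix.dotProduct_mulVec, ← Matrix.mulVec_transpose, hsym.eq, dotProduct_comm]
    rw [e4, dotProduct_sub, dotProduct_smul, e5, smul_eq_mul]
    have e6 : (∑ i, c i * (lift k i) ^ 2) + lift x ⬝ᵥ (A * P * ((2 : ℤ) • diagonal c)) *ᵥ (lift k)
        + 4 * q * (lift x ⬝ᵥ A *ᵥ lift x) = (∑ i, c i * (lift k i) ^ 2) +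
        (lift x ⬝ᵥ (A * P * ((2 : ℤ) • diagonal c)) *ᵥ (lift k) - 4 * q * (w ⬝ᵥ A *ᵥ lift x)) + m * z := by
      rw [hm]; push_cast; linear_combination 4 * (q : ℤ) * hz
    rw [e6, Int.cast_add, Int.cast_mul, hmz, zero_mul, add_zero, Int.cast_add]
  have hzero : ∀ k, v k = 0 → Q k = ((q * (w ⬝ᵥ A *ᵥ w) : ℤ) : ZMod m) := by
    intro k hk
    have h1 : ∀ j, ∃ z : ℤ, ((A * P * ((2 : ℤ) • diagonal c)) *ᵥ (lift k) - (4 * q : ℤ) • (A *ᵥ w)) j = m * z := by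
      intro j
      have := congrFun hk j
      exact (ZMod.intCast_zmod_eq_zero_iff_dvd _ _).mp this
    choose z hz using h1
    have h2 : (A * P * ((2 : ℤ) • diagonal c)) *ᵥ (lift k) - (4 * q : ℤ) • (A *ᵥ w) = (m : ℤ) • z := by
      ext j; rw [hz]; simp
    have h3 := congrArg (fun u => B *ᵥ u) h2
    simp only [Matrix.mulVec_sub, Matrix.mulVec_smul, Matrix.mulVec_mulVec, ← Matrix.mul_assoc, hBA,
      Matrix.one_mul, Matrix.one_mulVec] at h3
    set x := B *ᵥ z
    have h4 := congrArg (fun u => (Pᵀ * A) *ᵥ u) h3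
    have h5 : (Pᵀ * A) * (P * (2 : ℤ) • diagonal c) = (m : ℤ) • 1 := by
      rw [← Matrix.mul_assoc, hPAP, Matrix.mul_smul, diagonal_mul_diagonal,
        ← diagonal_one, ← diagonal_smul, ← diagonal_smul]
      congr 1
      ext i
      simp only [Pi.smul_apply, smul_eq_mul]
      linarith [hcd i]
    simp only [Matrix.mulVec_sub, Matrix.mulVec_smul] at h4
    rw [Matrix.mulVec_mulVec, h5, Matrix.smul_mulVec, Matrix.one_mulVec] at h4
    have h6 : ∀ i, 2 * lift k i = ((Pᵀ * A) *ᵥ (w + (2 : ℤ) • x)) i := by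
      intro i
      have := congrFun h4 i
      rw [Matrix.mulVec_add, Matrix.mulVec_smul]
      simp only [Pi.sub_apply, Pi.smul_apply, Pi.add_apply, smul_eq_mul] at this ⊢
      have hq' : (4 * q : ℤ) ≠ 0 := by positivity
      apply mul_left_cancel₀ hq'
      rw [hm] at this; push_cast at this
      linarith
    have h7 : 4 * (∑ i, c i * lift k i ^ 2) = 4 * q * ((w + (2 : ℤ) • x) ⬝ᵥ A *ᵥ (w + (2 : ℤ) • x)) := by
      rw [← hQ, Finset.mul_sum]
      exact Finset.sum_congr rfl fun i _ => by rw [← h6]; ring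
    obtain ⟨y, hy⟩ := hpar x
    have e5 : x ⬝ᵥ A *ᵥ w = w ⬝ᵥ A *ᵥ x := by
      rw [Matrix.dotProduct_mulVec, ← Matrix.mulVec_transpose, hsym.eq, dotProduct_comm]
    have h8 : (∑ i, c i * lift k i ^ 2) = q * (w ⬝ᵥ A *ᵥ w) + m * y := by
      simp only [Matrix.mulVec_add, Matrix.mulVec_smul, dotProduct_add, add_dotProduct,
        dotProduct_smul, smul_dotProduct, smul_eq_mul, e5] at h7
      rw [hm]; push_cast
      have : (4 : ℤ) ≠ 0 := by norm_num
      apply mul_left_cancel₀ this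
      linear_combination h7 + 16 * (q : ℤ) * hy
    have e2 : Q k = ((∑ i, c i * (lift k i) ^ 2 : ℤ) : ZMod m) := by
      simp only [Q]
      push_cast
      simp only [hl]
    rw [e2, h8, Int.cast_add, Int.cast_mul (m : ℤ), hmz, zero_mul, add_zero]
  -- character orthogonality
  have horth : ∀ u : Fin s → ZMod m, ∑ x : Fin s → ZMod m, (ZMod.stdAddChar (x ⬝ᵥ u) : ℂ) =
      if u = 0 then (Fintype.card (Fin s → ZMod m) : ℂ) else 0 := by
    intro u
    let ψ : AddChar (Fin s → ZMod m) ℂ :=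
      { toFun := fun x => ZMod.stdAddChar (x ⬝ᵥ u)
        map_zero_eq_one' := by simp
        map_add_eq_mul' := by intro x y; rw [add_dotProduct, AddChar.map_add_eq_mul] }
    have h := AddChar.sum_eq_ite ψ
    have h2 : ψ = 0 ↔ u = 0 := by
      constructor
      · intro h0
        ext i
        have h1 : ψ (Pi.single i 1) = 1 := by rw [h0]; simp
        have h3 : (ZMod.stdAddChar (u i) : ℂ) = ZMod.stdAddChar (0 : ZMod m) := by
          have : ψ (Pi.single i 1) = ZMod.stdAddChar (u i) := by
            change ZMod.stdAddChar (Pi.single i 1 ⬝ᵥ u) = _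
            rw [single_one_dotProduct]
          rw [← this, h1, AddChar.map_zero_eq_one]
        exact ZMod.injective_stdAddChar h3
      · rintro rfl
        ext x
        change ZMod.stdAddChar (x ⬝ᵥ 0) = _
        simp
    simp only [h2] at h
    exact h
  set N : ℂ := (Fintype.card (Fin s → ZMod m) : ℂ) with hN
  have hN0 : N ≠ 0 := by rw [hN]; exact_mod_cast Fintype.card_ne_zero
  refine ⟨(Finset.univ.filter fun k => v k = 0).card, ?_⟩
  apply mul_left_cancel₀ hN0
  change N * ∑ k, (ZMod.stdAddChar (Q k) : ℂ) = _
  calc N * ∑ k, (ZMod.stdAddChar (Q k) : ℂ)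
      = ∑ x : Fin s → ZMod m, ∑ k, (ZMod.stdAddChar (Q (k + M *ᵥ x)) : ℂ) := by
        have : ∀ x : Fin s → ZMod m, ∑ k, (ZMod.stdAddChar (Q (k + M *ᵥ x)) : ℂ) =
            ∑ k, (ZMod.stdAddChar (Q k) : ℂ) := fun x =>
          Equiv.sum_comp (Equiv.addRight (M *ᵥ x)) (fun k => (ZMod.stdAddChar (Q k) : ℂ))
        simp only [this, Finset.sum_const, Finset.card_univ, nsmul_eq_mul]
        rfl
    _ = ∑ k, (ZMod.stdAddChar (Q k) : ℂ) * ∑ x : Fin s → ZMod m, ZMod.stdAddChar (x ⬝ᵥ v k) := by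
        rw [Finset.sum_comm]
        simp only [hshift, AddChar.map_add_eq_mul, Finset.mul_sum]
    _ = ∑ k, if v k = 0 then N * ZMod.stdAddChar ((q * (w ⬝ᵥ A *ᵥ w) : ℤ) : ZMod m) else 0 := by
        refine Finset.sum_congr rfl fun k _ => ?_
        rw [horth]
        split_ifs with h
        · rw [hzero k h, mul_comm]
        · simp
    _ = _ := by
        rw [← Finset.sum_filter, Finset.sum_const, nsmul_eq_mul]; ring

lemma zgauss (c d : ℤ) (m : ℕ) [NeZero m] (hd : d ≠ 0) (hev : Even d) (h : 2 * c * d = m) :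
    ∃ r : ℝ, 0 < r ∧ ∑ k : ZMod m, (ZMod.stdAddChar ((c : ZMod m) * k ^ 2) : ℂ) =
      r * Complex.exp (Real.pi * Complex.I * (SignType.sign d : ℤ) / 4) := by
  have hm : (0 : ℤ) < m := by exact_mod_cast Nat.pos_of_ne_zero (NeZero.ne m)
  rcases lt_or_gt_of_ne hd with hneg | hpos
  · have hc : c < 0 := by
      by_contra hc
      push Not at hc
      nlinarith [mul_nonneg hc (neg_nonneg.mpr hneg.le)]
    obtain ⟨a, ha⟩ := Int.eq_ofNat_of_zero_le (neg_nonneg.mpr hneg.le)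
    obtain ⟨b, hb⟩ := Int.eq_ofNat_of_zero_le (neg_nonneg.mpr hc.le)
    obtain ⟨r, hr, e⟩ := zgauss_pos a b (by omega) (by omega)
      (by have := hev.neg; rw [ha] at this; exact_mod_cast this) m
      (by
        have : (m : ℤ) = 2 * b * a := by rw [← h, ← ha, ← hb]; ring
        exact_mod_cast this)
    refine ⟨r, hr, ?_⟩
    have e2 := congrArg (starRingEnd ℂ) e
    rw [map_sum] at e2
    have hcb : (c : ZMod m) = -(b : ZMod m) := by
      have : c = -(b : ℤ) := by omega
      rw [this]; push_cast; rfl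
    simp only [← AddChar.map_neg_eq_conj] at e2
    simp only [hcb, neg_mul]
    rw [e2, sign_neg hneg, map_mul, Complex.conj_ofReal, ← Complex.exp_conj]
    congr 2
    have h4 : (starRingEnd ℂ) 4 = 4 := by
      rw [show (4 : ℂ) = ((4 : ℝ) : ℂ) by norm_num, Complex.conj_ofReal]
    simp [Complex.conj_ofReal, h4]
  · have hc : 0 < c := by
      by_contra hc
      push Not at hc
      nlinarith [mul_nonneg (neg_nonneg.mpr hc) hpos.le]
    obtain ⟨a, ha⟩ := Int.eq_ofNat_of_zero_le hpos.le
    obtain ⟨b, hb⟩ := Int.eq_ofNat_of_zero_le hc.le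
    obtain ⟨r, hr, e⟩ := zgauss_pos a b (by omega) (by omega)
      (by rw [ha] at hev; exact_mod_cast hev) m
      (by
        have : (m : ℤ) = 2 * b * a := by rw [← h, ← ha, ← hb]
        exact_mod_cast this)
    refine ⟨r, hr, ?_⟩
    have hcb : (c : ZMod m) = (b : ZMod m) := by rw [hb]; push_cast; rfl
    rw [hcb, e, sign_pos hpos]
    simp

/-- Van der Blij's lemma: if `A` is a unimodular symmetric integer matrix and `w` is
characteristic for `A`, then `wᵗAw ≡ σ(A) (mod 8)`. -/
theorem van_der_Blij {s : ℕ} (A : Matrix (Fin s) (Fin s) ℤ) (hsym : A.IsSymm)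
    (hdet : A.det = 1 ∨ A.det = -1) (w : Fin s → ℤ) (hw : IsCharacteristic A w) :
    w ⬝ᵥ A.mulVec w ≡ intSignature A [ZMOD 8] := by
  have hdet0 : A.det ≠ 0 := by rcases hdet with h | h <;> rw [h] <;> norm_num
  obtain ⟨P, d, hP, hPAP, hd⟩ := exists_diag A hsym hdet0
  have hBA : A⁻¹ * A = 1 := nonsing_inv_mul _ (Int.isUnit_iff.mpr hdet)
  set q : ℕ := ∏ i, (d i).natAbs with hq
  have hq0 : 0 < q := Finset.prod_pos fun i _ => Int.natAbs_pos.mpr (hd i).1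
  have hdvd : ∀ i, ∃ c : ℤ, 2 * c * d i = ((8 * q : ℕ) : ℤ) := by
    intro i
    have : d i ∣ (q : ℤ) := by
      rw [← Int.natAbs_dvd]
      exact_mod_cast Finset.dvd_prod_of_mem (fun i => (d i).natAbs) (Finset.mem_univ i)
    obtain ⟨e, he⟩ := this
    exact ⟨4 * e, by push_cast; rw [he]; ring⟩
  choose c hc using hdvd
  have hmne : NeZero (8 * q) := ⟨by omega⟩
  obtain ⟨n, hn⟩ := main_sum A P A⁻¹ hsym hBA c d w q hq0 (8 * q) rfl hP hPAP hc hw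
  choose r hr hrs using fun i => zgauss (c i) (d i) (8 * q) (hd i).1 (hd i).2 (hc i)
  have hprod : ∑ k : Fin s → ZMod (8 * q),
      (ZMod.stdAddChar (∑ i, (c i : ZMod (8 * q)) * k i ^ 2) : ℂ) =
      ((∏ i, r i : ℝ) : ℂ) *
        Complex.exp (Real.pi * Complex.I * ((∑ i, (SignType.sign (d i) : ℤ) : ℤ) : ℂ) / 4) := by
    have hms : ∀ k : Fin s → ZMod (8 * q),
        (ZMod.stdAddChar (∑ i, (c i : ZMod (8 * q)) * k i ^ 2) : ℂ) =
        ∏ i, (ZMod.stdAddChar ((c i : ZMod (8 * q)) * k i ^ 2) : ℂ) := by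
      intro k
      have := map_prod (AddChar.toMonoidHom (ZMod.stdAddChar (N := 8 * q)))
        (fun i => Multiplicative.ofAdd ((c i : ZMod (8 * q)) * k i ^ 2)) Finset.univ
      rw [← ofAdd_sum] at this
      exact this
    simp only [hms]
    have := Finset.prod_univ_sum (fun _ : Fin s => (Finset.univ : Finset (ZMod (8 * q))))
      (fun i k => (ZMod.stdAddChar ((c i : ZMod (8 * q)) * k ^ 2) : ℂ))
    rw [Fintype.piFinset_univ] at this
    rw [← this]
    simp only [hrs]
    rw [Finset.prod_mul_distrib, ← Complex.exp_sum]
    push_cast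
    congr 2
    rw [Finset.mul_sum, Finset.sum_div]
  rw [hprod, ZMod.stdAddChar_coe] at hn
  have hqc : (q : ℂ) ≠ 0 := by exact_mod_cast hq0.ne'
  have hn' : ((∏ i, r i : ℝ) : ℂ) *
      Complex.exp (((Real.pi * ((∑ i, (SignType.sign (d i) : ℤ) : ℤ) : ℝ) / 4 : ℝ) : ℂ) * Complex.I) =
      ((n : ℝ) : ℂ) * Complex.exp (((Real.pi * ((w ⬝ᵥ A *ᵥ w : ℤ) : ℝ) / 4 : ℝ) : ℂ) * Complex.I) := by
    generalize (∑ i, (SignType.sign (d i) : ℤ)) = σ at hn ⊢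
    generalize w ⬝ᵥ A *ᵥ w = W at hn ⊢
    have e1 : ((Real.pi * (σ : ℝ) / 4 : ℝ) : ℂ) * Complex.I = Real.pi * Complex.I * (σ : ℂ) / 4 := by
      push_cast; ring
    have e2 : ((Real.pi * (W : ℝ) / 4 : ℝ) : ℂ) * Complex.I =
        2 * Real.pi * Complex.I * ((q * W : ℤ) : ℂ) / ((8 * q : ℕ) : ℂ) := by
      push_cast; field_simp; ring
    rw [e1, e2, hn, Complex.ofReal_natCast]
  have hRpos : 0 < ∏ i, r i := Finset.prod_pos fun i _ => hr i
  have hRn : ∏ i, r i = n := by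
    have := congrArg norm hn'
    rw [norm_mul, norm_mul, Complex.norm_exp_ofReal_mul_I, Complex.norm_exp_ofReal_mul_I,
      Complex.norm_real, Complex.norm_real, Real.norm_of_nonneg hRpos.le,
      Real.norm_of_nonneg (Nat.cast_nonneg n)] at this
    simpa using this
  rw [← hRn] at hn'
  have hexp := mul_left_cancel₀ (by exact_mod_cast hRpos.ne') hn'
  obtain ⟨z, hz⟩ := Complex.exp_eq_exp_iff_exists_int.mp hexp
  have hfin : (∑ i, (SignType.sign (d i) : ℤ)) = w ⬝ᵥ A *ᵥ w + 8 * z := by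
    have hpi : (Real.pi : ℂ) ≠ 0 := by exact_mod_cast Real.pi_ne_zero
    have hI := Complex.I_ne_zero
    generalize (∑ i, (SignType.sign (d i) : ℤ)) = σ at hz ⊢
    have : (σ : ℂ) = ((w ⬝ᵥ A *ᵥ w + 8 * z : ℤ) : ℂ) := by
      apply mul_left_cancel₀ (mul_ne_zero hpi hI)
      rw [Complex.ofReal_div, Complex.ofReal_div, Complex.ofReal_mul, Complex.ofReal_mul,
        Complex.ofReal_intCast, Complex.ofReal_intCast] at hz
      rw [Int.cast_add, Int.cast_mul]
      push_cast at hz ⊢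
      linear_combination 4 * hz
    exact_mod_cast this
  have hsig : intSignature A = ∑ i, (SignType.sign (d i) : ℤ) := by
    have hH : (A.map ((↑) : ℤ → ℝ)).IsHermitian := by
      rw [Matrix.IsHermitian, conjTranspose_eq_transpose_of_trivial, ← transpose_map, hsym.eq]
    rw [intSignature, dif_pos hH]
    have hmap : ∀ X Y : Matrix (Fin s) (Fin s) ℤ, (X * Y).map ((↑) : ℤ → ℝ) =
        X.map ((↑) : ℤ → ℝ) * Y.map ((↑) : ℤ → ℝ) := fun X Y =>
      Matrix.map_mul (f := Int.castRingHom ℝ)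
    have hPr : (P.map ((↑) : ℤ → ℝ)).det ≠ 0 := by
      have := RingHom.map_det (Int.castRingHom ℝ) P
      have e : (P.map ((↑) : ℤ → ℝ)).det = ((P.det : ℤ) : ℝ) := this.symm
      rw [e]; exact_mod_cast hP
    have hD : (P.map ((↑) : ℤ → ℝ))ᵀ * (A.map ((↑) : ℤ → ℝ)) * (P.map ((↑) : ℤ → ℝ)) =
        diagonal (fun i => ((d i : ℤ) : ℝ)) := by
      rw [← transpose_map, ← hmap, ← hmap, hPAP, diagonal_map (by simp)]
    obtain ⟨h1, h2⟩ := inertia_eq _ _ hH _ hPr hD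
    rw [h1, h2]
    simp only [Int.cast_pos, Int.cast_lt_zero]
    rw [Finset.card_filter, Finset.card_filter]
    push_cast
    rw [← Finset.sum_sub_distrib]
    refine Finset.sum_congr rfl fun i _ => ?_
    rcases lt_or_gt_of_ne (hd i).1 with h | h
    · simp [h, h.not_gt]
    · simp [h, h.not_gt]
  rw [hsig, hfin]
  exact (Int.modEq_iff_dvd).mpr ⟨z, by ring⟩
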